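/- There is no continuously differentiable function f : ℝ → ℝ such that for every C^∞ function g : ℝ → ℝ one has 2·∫₀¹ g(x)·f′(x) dx − (g(1)·f(1) − g(0)·f(0)) = −∫₀¹ g(x) dx. (Equivalently: the conditions f′(x) = −1/2 on [0,1] and f(0) = f(1) = 0 are incompatible, so the function H(φ) = ∫₀¹ φ(x) dx admits no Hamiltonian vector field with respect to the weakly nondegenerate symplectic structure Ω = ∫₀¹ ∂ₓδφ ∧ δφ dx on smooth functions on [0,1].) -/

import Mathlib

open intervalIntegral

theorem integral_pow_add_one_sub_pow (n : ℕ) :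
    ∫ x in (0:ℝ)..1, (x ^ n + (1 - x) ^ n) = 2 / (n + 1) := by
  have reflect : ∫ x in (0:ℝ)..1, (1 - x) ^ n = ∫ x in (0:ℝ)..1, x ^ n := by
    simpa using integral_comp_sub_left (a := 0) (b := 1) (fun x : ℝ => x ^ n) 1
  rw [integral_add (Continuous.intervalIntegrable (by fun_prop) _ _)
    (Continuous.intervalIntegrable (by fun_prop) _ _), reflect, integral_pow]
  simp
  ring

/-- There is no `C¹` function `f` with
`2∫₀¹ g f' - (g(1)f(1) - g(0)f(0)) = -∫₀¹ g` for every smooth `g`: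
the Hamiltonian function `H(φ) = ∫₀¹ φ` admits no Hamiltonian vector field with respect
to the weakly nondegenerate symplectic structure `Ω = ∫₀¹ ∂ₓδφ ∧ δφ dx`. -/
theorem no_hamiltonian_vector_field :
    ¬ ∃ f : ℝ → ℝ, ContDiff ℝ 1 f ∧
      ∀ g : ℝ → ℝ, ContDiff ℝ (⊤ : ℕ∞) g →
        2 * (∫ x in (0:ℝ)..1, g x * deriv f x) - (g 1 * f 1 - g 0 * f 0)
          = - ∫ x in (0:ℝ)..1, g x := by
  rintro ⟨f, hf, h⟩
  have hf' : Continuous (deriv f) := hf.continuous_deriv le_rfl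
  have jump : f 1 - f 0 = -1 := by
    have h1 := h (fun _ => 1) contDiff_const
    have ftc : ∫ x in (0:ℝ)..1, deriv f x = f 1 - f 0 :=
      integral_deriv_eq_sub (fun x _ => (hf.differentiable one_ne_zero) x)
        (hf'.intervalIntegrable _ _)
    simp only [one_mul, ftc, integral_const, sub_zero, smul_eq_mul] at h1
    linarith
  obtain ⟨C, hC⟩ := isCompact_Icc.exists_bound_of_continuousOn
    (s := Set.Icc (0:ℝ) 1) hf'.continuousOn
  obtain ⟨n, hn⟩ := exists_nat_gt (4 * C)
  have hn0 : n ≠ 0 := by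
    rintro rfl
    have := (norm_nonneg _).trans (hC 0 (by simp))
    norm_num at hn
    linarith
  have lower : -C * (2 / (n + 1)) ≤
      ∫ x in (0:ℝ)..1, (x ^ n + (1 - x) ^ n) * deriv f x := by
    rw [← integral_pow_add_one_sub_pow n, ← integral_const_mul]
    refine integral_mono_on zero_le_one (Continuous.intervalIntegrable (by fun_prop) _ _)
      (Continuous.intervalIntegrable (by fun_prop) _ _) fun x hx => ?_
    have hpos : 0 ≤ x ^ n + (1 - x) ^ n :=
      add_nonneg (pow_nonneg hx.1 n) (pow_nonneg (sub_nonneg.2 hx.2) n)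
    have hb := (abs_le.1 (hC x hx)).1
    nlinarith
  have hg := h (fun x => x ^ n + (1 - x) ^ n) (by fun_prop)
  simp only [integral_pow_add_one_sub_pow, one_pow, sub_self, sub_zero, zero_pow hn0, add_zero,
    zero_add, one_mul] at hg
  have hn1 : (0:ℝ) < n + 1 := by positivity
  have small : 4 * C / ((n:ℝ) + 1) < 1 := (div_lt_one hn1).2 (by linarith)
  have pos : 0 < 2 / ((n:ℝ) + 1) := by positivity
  have : 4 * C / ((n:ℝ) + 1) = 2 * (C * (2 / (n + 1))) := by ring
  linarith
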